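/- (Main theorem on T-RaCBFs.) Let f : ℝⁿ → ℝⁿ, G : ℝⁿ → ℝ^{n×m}, Φ : ℝⁿ → ℝ^{m×p} be continuous, h : ℝⁿ → ℝ continuously differentiable, θ ∈ ℝᵖ, Γ ∈ ℝ^{p×p} symmetric positive definite with zᵀ Γ z ≥ λ‖z‖² for all z ∈ ℝᵖ and some λ > 0, α > 0, and β > 0 with β ≥ α/λ. Define ψ(x) := (∇h(x)ᵀ G(x) Φ(x))ᵀ and h_a(x, ν, θ̂) := h(x) − ½ (θ − ν)ᵀ Γ⁻¹ (θ − ν) − ½ (ν − θ̂)ᵀ Γ⁻¹ (ν − θ̂). Let T ∈ (0, ∞] and let x : [0, T) → ℝⁿ, ν, θ̂ : [0, T) → ℝᵖ, u : [0, T) → ℝᵐ, ϑ̃ : [0, T) → ℝᵖ be such that x, ν, θ̂ are differentiable with x′(t) = f(x(t)) + G(x(t))(u(t) + Φ(x(t)) θ), ν′(t) = −Γ ψ(x(t)), θ̂′(t) = β Γ (ν(t) − θ̂(t)); the weighted error bound (θ − ν(t))ᵀ Γ⁻¹ (θ − ν(t)) ≤ ϑ̃(t)ᵀ Γ⁻¹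 ϑ̃(t) holds; and the T-RaCBF condition ∇h(x(t)) ⋅ ( f(x(t)) + G(x(t))(u(t) + Φ(x(t)) θ̂(t)) ) ≥ −α[ h(x(t)) − ½ ϑ̃(t)ᵀ Γ⁻¹ ϑ̃(t) ] + (2/β) ‖ψ(x(t))‖² holds for all t ∈ [0, T). If h_a(x(0), ν(0), θ̂(0)) ≥ 0, then h_a(x(t), ν(t), θ̂(t)) ≥ 0 and h(x(t)) ≥ 0 for all t ∈ [0, T). -/

import Mathlib

open Matrix

/-- `ψ(x) := (∇h(x)ᵀ G(x) Φ(x))ᵀ ∈ ℝᵖ`. -/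
noncomputable def psi {n m p : ℕ} (h : (Fin n → ℝ) → ℝ)
    (G : (Fin n → ℝ) → Matrix (Fin n) (Fin m) ℝ)
    (Φ : (Fin n → ℝ) → Matrix (Fin m) (Fin p) ℝ)
    (x : Fin n → ℝ) : Fin p → ℝ :=
  fun j => fderiv ℝ h x (fun i => (G x * Φ x) i j)

/-- High-order tuner augmented barrier candidate
`h_a(x, ν, θ̂) := h(x) - ½ (θ - ν)ᵀ Γ⁻¹ (θ - ν) - ½ (ν - θ̂)ᵀ Γ⁻¹ (ν - θ̂)`. -/
noncomputable def hAhot {n p : ℕ} (h : (Fin n → ℝ) → ℝ) (θ : Fin p → ℝ)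
    (Γ : Matrix (Fin p) (Fin p) ℝ) (x : Fin n → ℝ) (ν θhat : Fin p → ℝ) : ℝ :=
  h x - (1 / 2) * ((θ - ν) ⬝ᵥ (Γ⁻¹ *ᵥ (θ - ν)))
      - (1 / 2) * ((ν - θhat) ⬝ᵥ (Γ⁻¹ *ᵥ (ν - θhat)))

theorem HasDerivAt.dotProduct {ι : Type*} [Fintype ι] {a b : ℝ → ι → ℝ} {a' b' : ι → ℝ} {t : ℝ}
    (ha : HasDerivAt a a' t) (hb : HasDerivAt b b' t) :
    HasDerivAt (fun s => a s ⬝ᵥ b s) (a' ⬝ᵥ b t + a t ⬝ᵥ b') t := by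
  simp only [_root_.dotProduct, ← Finset.sum_add_distrib]
  exact HasDerivAt.fun_sum fun i _ => (hasDerivAt_pi.1 ha i).mul (hasDerivAt_pi.1 hb i)

theorem HasDerivAt.matrix_mulVec {ι κ : Type*} [Fintype ι] [Fintype κ] (A : Matrix κ ι ℝ)
    {b : ℝ → ι → ℝ} {b' : ι → ℝ} {t : ℝ} (hb : HasDerivAt b b' t) :
    HasDerivAt (fun s => A *ᵥ b s) (A *ᵥ b') t := by
  refine hasDerivAt_pi.2 fun i => ?_
  simpa [Matrix.mulVec] using (hasDerivAt_const t (A i)).dotProduct hb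

theorem Matrix.IsSymm.dotProduct_mulVec_comm {ι R : Type*} [Fintype ι] [CommSemiring R]
    {A : Matrix ι ι R} (hA : A.IsSymm) (v w : ι → R) : v ⬝ᵥ (A *ᵥ w) = w ⬝ᵥ (A *ᵥ v) := by
  rw [Matrix.dotProduct_mulVec, ← Matrix.mulVec_transpose, hA.eq, dotProduct_comm]

theorem Matrix.IsSymm.hasDerivAt_quadratic {ι : Type*} [Fintype ι] {A : Matrix ι ι ℝ}
    (hA : A.IsSymm) {b : ℝ → ι → ℝ} {b' : ι → ℝ} {t : ℝ} (hb : HasDerivAt b b' t) :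
    HasDerivAt (fun s => b s ⬝ᵥ (A *ᵥ b s)) (2 * (b t ⬝ᵥ (A *ᵥ b'))) t := by
  convert hb.dotProduct (hb.matrix_mulVec A) using 1
  rw [hA.dotProduct_mulVec_comm b' (b t)]
  ring

/-- A lower bound on the quadratic form of `A` gives an upper bound on that of `A⁻¹`. -/
theorem Matrix.mul_dotProduct_inv_mulVec_le {ι : Type*} [Fintype ι] [DecidableEq ι]
    {A : Matrix ι ι ℝ} (hA : IsUnit A.det) {c : ℝ} (hc : 0 ≤ c)
    (hlow : ∀ z : ι → ℝ, c * (z ⬝ᵥ z) ≤ z ⬝ᵥ (A *ᵥ z)) (d : ι → ℝ) :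
    c * (d ⬝ᵥ (A⁻¹ *ᵥ d)) ≤ d ⬝ᵥ d := by
  have hw := hlow (A⁻¹ *ᵥ d)
  rw [Matrix.mulVec_mulVec, Matrix.mul_nonsing_inv _ hA, Matrix.one_mulVec,
    dotProduct_comm _ d] at hw
  have hsq : 0 ≤ (d - c • (A⁻¹ *ᵥ d)) ⬝ᵥ (d - c • (A⁻¹ *ᵥ d)) :=
    Finset.sum_nonneg fun i _ => mul_self_nonneg _
  simp only [sub_dotProduct, dotProduct_sub, smul_dotProduct, dotProduct_smul, smul_eq_mul,
    dotProduct_comm (A⁻¹ *ᵥ d) d] at hsq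
  nlinarith [mul_le_mul_of_nonneg_left hw hc]

theorem psi_dotProduct {n m p : ℕ} (h : (Fin n → ℝ) → ℝ)
    (G : (Fin n → ℝ) → Matrix (Fin n) (Fin m) ℝ) (Φ : (Fin n → ℝ) → Matrix (Fin m) (Fin p) ℝ)
    (x : Fin n → ℝ) (w : Fin p → ℝ) :
    psi h G Φ x ⬝ᵥ w = fderiv ℝ h x (G x *ᵥ (Φ x *ᵥ w)) := by
  have hcol : G x *ᵥ (Φ x *ᵥ w) = ∑ j, w j • fun i => (G x * Φ x) i j := by
    ext i
    rw [Matrix.mulVec_mulVec]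
    simp [Matrix.mulVec, dotProduct, mul_comm]
  rw [hcol, map_sum]
  simp [psi, dotProduct, mul_comm]

/-- A comparison principle: `g' ≥ -α g` preserves nonnegativity. -/
theorem nonneg_of_neg_mul_le_deriv {g g' : ℝ → ℝ} {α t : ℝ} (ht : 0 ≤ t)
    (hg : ∀ s ∈ Set.Icc 0 t, HasDerivAt g (g' s) s)
    (hle : ∀ s ∈ Set.Icc 0 t, -α * g s ≤ g' s) (h0 : 0 ≤ g 0) : 0 ≤ g t := by
  have hd : ∀ s ∈ Set.Icc 0 t, HasDerivAt (fun s => Real.exp (α * s) * g s)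
      (Real.exp (α * s) * (α * g s + g' s)) s := fun s hs => by
    refine ((((hasDerivAt_id s).const_mul α).exp).mul (hg s hs)).congr_deriv ?_
    simp only [id]
    ring
  have hmono : MonotoneOn (fun s => Real.exp (α * s) * g s) (Set.Icc 0 t) := by
    refine monotoneOn_of_hasDerivWithinAt_nonneg (convex_Icc 0 t)
      (fun s hs => (hd s hs).continuousAt.continuousWithinAt)
      (fun s hs => (hd s (interior_subset hs)).hasDerivWithinAt) fun s hs => ?_
    have := hle s (interior_subset hs)
    exact mul_nonneg (Real.exp_pos _).le (by linarith)
  have h1 := hmono (Set.left_mem_Icc.2 ht) (Set.right_mem_Icc.2 ht) ht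
  simp only [mul_zero, Real.exp_zero, one_mul] at h1
  exact nonneg_of_mul_nonneg_right (h0.trans h1) (Real.exp_pos _)

/-- main theorem on T-RaCBFs: under the high-order tuner update laws, the
weighted intermediate-error bound, the T-RaCBF condition, and the gain condition
`β ≥ α / lam` (with `lam` a lower bound on the quadratic form of `Γ`), nonnegativity of
the augmented barrier candidate is forward invariant, and hence `h (x t) ≥ 0`. -/
theorem stmt_7 {n m p : ℕ}
    (f : (Fin n → ℝ) → (Fin n → ℝ))
    (G : (Fin n → ℝ) → Matrix (Fin n) (Fin m) ℝ)
    (Φ : (Fin n → ℝ) → Matrix (Fin m) (Fin p) ℝ)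
    (hf : Continuous f) (hG : Continuous G) (hΦ : Continuous Φ)
    (h : (Fin n → ℝ) → ℝ) (hh : ContDiff ℝ 1 h)
    (θ : Fin p → ℝ) (Γ : Matrix (Fin p) (Fin p) ℝ) (hΓ : Γ.PosDef)
    (lam : ℝ) (hlam : 0 < lam)
    (hΓlow : ∀ z : Fin p → ℝ, z ⬝ᵥ (Γ *ᵥ z) ≥ lam * (z ⬝ᵥ z))
    (α : ℝ) (hαpos : 0 < α)
    (β : ℝ) (hβ : 0 < β) (hβα : β ≥ α / lam)
    (T : EReal) (hT : 0 < T)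
    (x : ℝ → Fin n → ℝ) (ν θhat : ℝ → Fin p → ℝ) (u : ℝ → Fin m → ℝ)
    (ϑ : ℝ → Fin p → ℝ)
    (hx : ∀ t : ℝ, 0 ≤ t → (t : EReal) < T →
      HasDerivAt x (f (x t) + G (x t) *ᵥ (u t + Φ (x t) *ᵥ θ)) t)
    (hν : ∀ t : ℝ, 0 ≤ t → (t : EReal) < T →
      HasDerivAt ν (-(Γ *ᵥ psi h G Φ (x t))) t)
    (hθhat : ∀ t : ℝ, 0 ≤ t → (t : EReal) < T →
      HasDerivAt θhat (β • (Γ *ᵥ (ν t - θhat t))) t)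
    (herr : ∀ t : ℝ, 0 ≤ t → (t : EReal) < T →
      (θ - ν t) ⬝ᵥ (Γ⁻¹ *ᵥ (θ - ν t)) ≤ ϑ t ⬝ᵥ (Γ⁻¹ *ᵥ ϑ t))
    (htracbf : ∀ t : ℝ, 0 ≤ t → (t : EReal) < T →
      fderiv ℝ h (x t) (f (x t) + G (x t) *ᵥ (u t + Φ (x t) *ᵥ θhat t)) ≥
        -α * (h (x t) - (1 / 2) * (ϑ t ⬝ᵥ (Γ⁻¹ *ᵥ ϑ t)))
          + (2 / β) * (psi h G Φ (x t) ⬝ᵥ psi h G Φ (x t)))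
    (h0 : hAhot h θ Γ (x 0) (ν 0) (θhat 0) ≥ 0) :
    ∀ t : ℝ, 0 ≤ t → (t : EReal) < T →
      hAhot h θ Γ (x t) (ν t) (θhat t) ≥ 0 ∧ h (x t) ≥ 0 := by
  have hdet : IsUnit Γ.det := hΓ.det_pos.ne'.isUnit
  have hsymm : (Γ⁻¹).IsSymm := by
    simpa [Matrix.IsHermitian, Matrix.IsSymm, Matrix.conjTranspose_eq_transpose_of_trivial]
      using hΓ.isHermitian.inv
  have hcancel : ∀ v, Γ⁻¹ *ᵥ (Γ *ᵥ v) = v := fun v => by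
    rw [Matrix.mulVec_mulVec, Matrix.nonsing_inv_mul _ hdet, Matrix.one_mulVec]
  have hquad : ∀ v : Fin p → ℝ, 0 ≤ v ⬝ᵥ (Γ⁻¹ *ᵥ v) := fun v => by
    simpa using hΓ.inv.posSemidef.dotProduct_mulVec_nonneg v
  have hderiv : ∀ s : ℝ, 0 ≤ s → (s : EReal) < T →
      HasDerivAt (fun s => hAhot h θ Γ (x s) (ν s) (θhat s))
        (fderiv ℝ h (x s) (f (x s) + G (x s) *ᵥ (u s + Φ (x s) *ᵥ θhat s))
          + 2 * (psi h G Φ (x s) ⬝ᵥ (ν s - θhat s))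
          + β * ((ν s - θhat s) ⬝ᵥ (ν s - θhat s))) s := by
    intro s hs hsT
    have hhx := ((hh.differentiable one_ne_zero (x s)).hasFDerivAt).comp_hasDerivAt s (hx s hs hsT)
    have he := hsymm.hasDerivAt_quadratic ((hν s hs hsT).const_sub θ)
    have hd := hsymm.hasDerivAt_quadratic ((hν s hs hsT).sub (hθhat s hs hsT))
    have hψ := psi_dotProduct h G Φ (x s) (θ - θhat s)
    have hsum : HasDerivAt (fun s => hAhot h θ Γ (x s) (ν s) (θhat s)) _ s :=
      (hhx.sub (he.const_mul (1 / 2))).sub (hd.const_mul (1 / 2))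
    refine hsum.congr_deriv ?_
    simp only [neg_neg, Matrix.mulVec_sub, Matrix.mulVec_add, Matrix.mulVec_neg,
      Matrix.mulVec_smul, hcancel, map_add, map_sub, Pi.sub_apply, sub_dotProduct, dotProduct_sub,
      dotProduct_neg, dotProduct_smul, smul_eq_mul, dotProduct_comm _ (psi h G Φ (x s))] at hψ ⊢
    linarith
  have hbound : ∀ s : ℝ, 0 ≤ s → (s : EReal) < T →
      -α * hAhot h θ Γ (x s) (ν s) (θhat s) ≤
        fderiv ℝ h (x s) (f (x s) + G (x s) *ᵥ (u s + Φ (x s) *ᵥ θhat s))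
          + 2 * (psi h G Φ (x s) ⬝ᵥ (ν s - θhat s))
          + β * ((ν s - θhat s) ⬝ᵥ (ν s - θhat s)) := by
    intro s hs hsT
    have hcbf := htracbf s hs hsT
    have hw := mul_le_mul_of_nonneg_left (herr s hs hsT) hαpos.le
    have hinv := Matrix.mul_dotProduct_inv_mulVec_le hdet hlam.le hΓlow (ν s - θhat s)
    have hgain : α * ((ν s - θhat s) ⬝ᵥ (Γ⁻¹ *ᵥ (ν s - θhat s))) ≤
        β * ((ν s - θhat s) ⬝ᵥ (ν s - θhat s)) :=
      calc _ ≤ β * lam * ((ν s - θhat s) ⬝ᵥ (Γ⁻¹ *ᵥ (ν s - θhat s))) :=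
            mul_le_mul_of_nonneg_right ((div_le_iff₀ hlam).1 hβα) (hquad _)
        _ ≤ _ := by
            rw [mul_assoc]
            exact mul_le_mul_of_nonneg_left hinv hβ.le
    have hsq : 0 ≤ 2 / β * (psi h G Φ (x s) ⬝ᵥ psi h G Φ (x s))
        + 2 * (psi h G Φ (x s) ⬝ᵥ (ν s - θhat s))
        + β / 2 * ((ν s - θhat s) ⬝ᵥ (ν s - θhat s)) := by
      simp only [dotProduct, Finset.mul_sum, ← Finset.sum_add_distrib]
      refine Finset.sum_nonneg fun i _ => ?_
      have : 0 ≤ (2 * psi h G Φ (x s) i + β * (ν s - θhat s) i) ^ 2 / (2 * β) := by positivity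
      refine this.trans_eq ?_
      field_simp
      ring
    unfold hAhot
    linarith
  intro t ht htT
  have hpos : 0 ≤ hAhot h θ Γ (x t) (ν t) (θhat t) :=
    nonneg_of_neg_mul_le_deriv (α := α) (g := fun s => hAhot h θ Γ (x s) (ν s) (θhat s)) ht
      (fun s hs => hderiv s hs.1 ((EReal.coe_le_coe_iff.2 hs.2).trans_lt htT))
      (fun s hs => hbound s hs.1 ((EReal.coe_le_coe_iff.2 hs.2).trans_lt htT)) h0
  refine ⟨hpos, ?_⟩
  have he := hquad (θ - ν t)
  have hd := hquad (ν t - θhat t)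
  unfold hAhot at hpos
  linarith
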